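/- arXiv:1009.2936 — 4 statements merged into one kernel-verified Lean document; each statement's English description precedes it below -/
import Mathlib

section
/- Let n ≥ 1, let Λ be a skew-symmetric n×n integer matrix, and let T be a subgroup of ℤⁿ such that the only w ∈ ℤⁿ satisfying both Λw = 0 and w·b = 0 for all b ∈ T is w = 0. If I is a nonzero prime ideal of the polynomial ring ℂ[x₁,…,xₙ] that is a Poisson ideal for the log-canonical bracket of Λ and is T-torus-invariant, then I contains one of the variables x_i. -/
open MvPolynomial Matrix

/-- Let `f` have the fewest terms among the nonzero elements of the ideal `I`. If rescaling the
terms of `f` by `c` and shifting them by `s` gives an element of `I`, then `c` is constant on the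
support of `f`. -/
theorem MvPolynomial.scaling_eq_of_minimal_support {σ K : Type*} [Field K]
    {I : Ideal (MvPolynomial σ K)} {f : MvPolynomial σ K} (hf : f ∈ I)
    (hmin : ∀ g ∈ I, g ≠ 0 → f.support.card ≤ g.support.card)
    (s : σ →₀ ℕ) (c : (σ →₀ ℕ) → K)
    (hc : ∑ m ∈ f.support, monomial (s + m) (c m * coeff m f) ∈ I)
    {u v : σ →₀ ℕ} (hu : u ∈ f.support) (hv : v ∈ f.support) : c u = c v := by
  classical
  by_contra huv
  set h : MvPolynomial σ K := ∑ m ∈ f.support, monomial (s + m) ((c m - c u) * coeff m f) with hh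
  have hI : h ∈ I := by
    have key : h = ∑ m ∈ f.support, monomial (s + m) (c m * coeff m f) - monomial s (c u) * f := by
      conv_rhs => rw [f.as_sum, Finset.mul_sum]
      simp only [support_sum_monomial_coeff, monomial_mul]
      simp [hh, sub_mul, Finset.sum_sub_distrib]
    rw [key]
    exact I.sub_mem hc (I.mul_mem_left _ hf)
  have hne : h ≠ 0 := by
    intro h0
    have hcoeff : coeff (s + v) h = (c v - c u) * coeff v f := by
      simp only [hh, coeff_sum, coeff_monomial, add_right_inj]
      rw [Finset.sum_ite_eq' f.support v, if_pos hv]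
    rw [h0, coeff_zero] at hcoeff
    exact mul_ne_zero (sub_ne_zero.2 (Ne.symm huv)) (mem_support_iff.1 hv) hcoeff.symm
  have hsub : h.support ⊆ (f.support.erase u).image (s + ·) := by
    intro m hm
    obtain ⟨k, hk, hmk⟩ := Finset.exists_ne_zero_of_sum_ne_zero
      (by simpa [hh, coeff_sum] using hm :
        ∑ k ∈ f.support, coeff m (monomial (s + k) ((c k - c u) * coeff k f)) ≠ 0)
    rw [coeff_monomial] at hmk
    refine Finset.mem_image.2 ⟨k, Finset.mem_erase.2 ⟨?_, hk⟩, ?_⟩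
    · rintro rfl
      simp at hmk
    · by_contra hne'
      exact hmk (if_neg hne')
  have := (hmin h hI hne).trans ((Finset.card_le_card hsub).trans Finset.card_image_le)
  rw [Finset.card_erase_of_mem hu] at this
  have := Finset.card_pos.2 ⟨u, hu⟩
  omega

/-- A prime ideal containing a monomial with nonzero coefficient contains a variable. -/
theorem MvPolynomial.exists_X_mem_of_monomial_mem {σ K : Type*} [Field K]
    {I : Ideal (MvPolynomial σ K)} (hI : I.IsPrime) {u : σ →₀ ℕ} {a : K} (ha : a ≠ 0)
    (h : monomial u a ∈ I) : ∃ i, X i ∈ I := by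
  rw [monomial_eq, Finsupp.prod] at h
  rcases hI.mem_or_mem h with h | h
  · exact absurd (I.eq_top_of_isUnit_mem h ((isUnit_iff_ne_zero.2 ha).map C)) hI.ne_top
  · obtain ⟨i, -, hi⟩ := hI.prod_mem_iff.1 h
    exact ⟨i, hI.mem_of_pow_mem _ hi⟩

theorem zpow_sum_eq_prod {ι K : Type*} [Field K] {a : K} (ha : a ≠ 0) (t : Finset ι) (k : ι → ℤ) :
    a ^ (∑ i ∈ t, k i) = ∏ i ∈ t, a ^ k i := by
  classical
  induction t using Finset.induction_on with
  | empty => simp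
  | insert i t hi ih => rw [Finset.sum_insert hi, Finset.prod_insert hi, zpow_add₀ ha, ih]

/-- Let `n ≥ 1`, `Λ` a skew-symmetric `n×n` integer matrix, and `T` a subgroup
of `ℤⁿ` such that the only `w ∈ ℤⁿ` with `Λ w = 0` and `w ⬝ b = 0` for all `b ∈ T` is `w = 0`.
Any nonzero prime ideal of `ℂ[x₁,…,xₙ]` which is a Poisson ideal for the log-canonical bracket
of `Λ` and is invariant under all torus automorphisms `ψ_{b,α}` (`b ∈ T`, `α ∈ ℂˣ`)
contains some variable `xᵢ`. -/
theorem toric_poisson_prime_contains_variable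
    (n : ℕ) (hn : 1 ≤ n)
    (Λ : Matrix (Fin n) (Fin n) ℤ) (hΛ : Λᵀ = -Λ)
    (T : AddSubgroup (Fin n → ℤ))
    (hTΛ : ∀ w : Fin n → ℤ, Λ.mulVec w = 0 →
      (∀ b ∈ T, ∑ i, w i * b i = 0) → w = 0)
    (br : MvPolynomial (Fin n) ℂ →ₗ[ℂ] MvPolynomial (Fin n) ℂ →ₗ[ℂ] MvPolynomial (Fin n) ℂ)
    (hbr : ∀ u v : Fin n →₀ ℕ,
      br (monomial u 1) (monomial v 1) =
        ((∑ i, ∑ j, (u i : ℤ) * Λ i j * (v j : ℤ)) : ℤ) • monomial (u + v) (1 : ℂ))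
    (I : Ideal (MvPolynomial (Fin n) ℂ)) (hIbot : I ≠ ⊥) (hIprime : I.IsPrime)
    (hIPoisson : ∀ a : MvPolynomial (Fin n) ℂ, ∀ h ∈ I, br a h ∈ I)
    (hItorus : ∀ b ∈ T, ∀ α : ℂˣ,
      I.map (aeval (R := ℂ) fun i => ((α ^ b i : ℂˣ) : ℂ) • X i).toRingHom = I) :
    ∃ i : Fin n, X i ∈ I := by
  classical
  obtain ⟨f, ⟨hf, hf0⟩, hmin⟩ : ∃ f : MvPolynomial (Fin n) ℂ, (f ∈ I ∧ f ≠ 0) ∧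
      ∀ g ∈ I, g ≠ 0 → f.support.card ≤ g.support.card := by
    obtain ⟨f₀, hf₀⟩ := Submodule.exists_mem_ne_zero_of_ne_bot hIbot
    obtain ⟨f, hf, hmin⟩ := exists_minimalFor_of_wellFoundedLT
      (fun g => g ∈ I ∧ g ≠ 0) (fun g : MvPolynomial (Fin n) ℂ => g.support.card) ⟨f₀, hf₀⟩
    exact ⟨f, hf, fun g hg hg0 => (le_total _ _).elim id (hmin ⟨hg, hg0⟩)⟩
  obtain ⟨u, hu⟩ := support_nonempty.2 hf0
  suffices hsupp : ∀ v ∈ f.support, v = u by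
    have hfu : f = monomial u (coeff u f) := by
      conv_lhs => rw [f.as_sum, Finset.eq_singleton_iff_unique_mem.2 ⟨hu, hsupp⟩]
      simp
    rw [hfu] at hf
    exact exists_X_mem_of_monomial_mem hIprime (mem_support_iff.1 hu) hf
  intro v hv
  have hw : (fun i => (v i : ℤ) - u i) = 0 := by
    apply hTΛ
    · ext i
      have hmem : ∑ m ∈ f.support, monomial (Finsupp.single i 1 + m)
          (((∑ j, Λ i j * (m j : ℤ) : ℤ) : ℂ) * coeff m f) ∈ I := by
        convert hIPoisson (X i) f hf using 1
        conv_rhs => rw [f.as_sum]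
        rw [map_sum]
        refine Finset.sum_congr rfl fun m _ => ?_
        have hm : monomial m (coeff m f) = coeff m f • monomial m (1 : ℂ) := by
          simp [smul_monomial]
        have hrow : ∑ k, ∑ j, ((Finsupp.single i 1 : Fin n →₀ ℕ) k : ℤ) * Λ k j * (m j : ℤ) =
            ∑ j, Λ i j * (m j : ℤ) := by
          rw [Finset.sum_eq_single i]
          · simp
          · intro k _ hk
            simp [Finsupp.single_eq_of_ne hk]
          · simp
        rw [hm, map_smul, X, hbr, hrow, ← Int.cast_smul_eq_zsmul ℂ, smul_smul, smul_monomial]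
        simp [mul_comm]
      have heq := scaling_eq_of_minimal_support hf hmin _ _ hmem hu hv
      have heq' := Int.cast_injective heq
      simp [Matrix.mulVec, dotProduct, mul_sub, Finset.sum_sub_distrib, heq']
    · intro b hb
      have hmem : ∑ m ∈ f.support, monomial (0 + m)
          ((2 : ℂ) ^ (∑ i, (m i : ℤ) * b i) * coeff m f) ∈ I := by
        have h2 : (2 : ℂ) ≠ 0 := two_ne_zero
        have h := Ideal.mem_map_of_mem
          (aeval (R := ℂ) fun i => ((Units.mk0 2 h2 ^ b i : ℂˣ) : ℂ) •
            (X i : MvPolynomial (Fin n) ℂ)).toRingHom hf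
        rw [hItorus b hb] at h
        convert h using 1
        conv_rhs => rw [f.as_sum]
        rw [map_sum]
        refine Finset.sum_congr rfl fun m _ => ?_
        have hprod : ∏ i, ((2 : ℂ) ^ b i) ^ m i = (2 : ℂ) ^ (∑ i, (m i : ℤ) * b i) := by
          rw [zpow_sum_eq_prod h2]
          refine Finset.prod_congr rfl fun i _ => ?_
          rw [mul_comm, _root_.zpow_mul, zpow_natCast]
        have hX : ∏ i, (X i : MvPolynomial (Fin n) ℂ) ^ m i = monomial m 1 := by
          rw [monomial_eq, Finsupp.prod_fintype _ _ (by simp)]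
          simp
        simp only [AlgHom.toRingHom_eq_coe, RingHom.coe_coe, aeval_monomial]
        rw [Finsupp.prod_fintype _ _ (by simp)]
        simp only [smul_pow, Units.val_zpow_eq_zpow_val, Units.val_mk0]
        rw [Finset.prod_smul, hprod, hX, algebraMap_eq, smul_monomial, C_mul_monomial]
        simp [mul_comm]
      have heq := scaling_eq_of_minimal_support hf hmin _ _ hmem hu hv
      have hreal : (2 : ℝ) ^ (∑ i, (u i : ℤ) * b i) = 2 ^ (∑ i, (v i : ℤ) * b i) := by
        simpa using congrArg norm heq
      have heq' := zpow_right_injective₀ two_pos (by norm_num) hreal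
      simp [sub_mul, Finset.sum_sub_distrib, heq']
  ext i
  have := congrFun hw i
  simp only [Pi.zero_apply] at this
  omega
end

section
/- Let A be a commutative ℂ-algebra equipped with a Poisson bracket {·,·}, and let S ⊆ A be a Poisson multiplicative set, i.e. a multiplicative submonoid with {s,t} ∈ S ∪ {0} for all s, t ∈ S. Then there exists a Poisson bracket {·,·}' on the localization A[S⁻¹] (ℂ-bilinear, skew-symmetric, satisfying the Jacobi identity and the Leibniz rule) such that the localization map ι : A → A[S⁻¹] is a homomorphism of Poisson algebras, i.e. {ι(a), ι(b)}' = ι({a,b}) for all a, b ∈ A. -/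
section

variable {R A B M : Type*} [CommRing R] [CommRing A] [CommRing B] [Algebra R B]
  [Algebra A B] [AddCommGroup M] [Module R M] [Module B M]

/-- A derivation on a localization is determined by its values on the image of the base ring. -/
theorem Derivation.ext_of_isLocalization (S : Submonoid A) [IsLocalization S B]
    {D₁ D₂ : Derivation R B M}
    (h : ∀ a : A, D₁ (algebraMap A B a) = D₂ (algebraMap A B a)) : D₁ = D₂ := by
  ext x
  obtain ⟨⟨a, s⟩, hx⟩ := IsLocalization.surj S x
  have h₁ := congrArg D₁ hx
  have h₂ := congrArg D₂ hx
  simp only [Derivation.leibniz, h] at h₁ h₂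
  exact (IsLocalization.map_units B s).smul_left_cancel.mp
    (add_left_cancel (h₁.trans h₂.symm))

/-- A derivation into a module over the localization extends to the localization. -/
theorem Derivation.exists_extension_of_isLocalization [Algebra R A] [IsScalarTower R A B]
    [Module A M] [IsScalarTower R A M] [IsScalarTower R B M] [IsScalarTower A B M]
    (S : Submonoid A) [IsLocalization S B]
    (D : Derivation R A M) :
    ∃ D' : Derivation R B M, ∀ a : A, D' (algebraMap A B a) = D a := by
  have hunit (s : S) : IsUnit (algebraMap A (Module.End A M) s) := by
    have := (IsLocalization.map_units B s).map (Algebra.lsmul A A M : B →ₐ[A] Module.End A M)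
    rwa [AlgHom.commutes] at this
  let f := IsLocalizedModule.lift S (KaehlerDifferential.map R R A B)
    D.liftKaehlerDifferential hunit
  refine ⟨(f.extendScalarsOfIsLocalization S B).compDer (KaehlerDifferential.D R B),
    fun a ↦ ?_⟩
  have h := IsLocalizedModule.lift_apply S (KaehlerDifferential.map R R A B)
    D.liftKaehlerDifferential hunit (KaehlerDifferential.D R A a)
  rw [KaehlerDifferential.map_D, Derivation.liftKaehlerDifferential_comp_D] at h
  exact h

end

section

variable {R B : Type*} [CommRing R] [CommRing B] [Algebra R B]

/-- Evaluation at a fixed element, as a linear map on derivations. -/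
def Derivation.evalLinearMap (x : B) : Derivation R B B →ₗ[B] B where
  toFun D := D x
  map_add' _ _ := rfl
  map_smul' _ _ := rfl

end

section

variable {R A B : Type*} [CommRing R] [CommRing A] [CommRing B] [Algebra R A] [Algebra R B]
  [Algebra A B] [IsScalarTower R A B]

/-- A biderivation on a ring extends to a biderivation on a localization. -/
theorem exists_biderivation_of_isLocalization (br : A →ₗ[R] A →ₗ[R] A)
    (hleft : ∀ a b c : A, br (a * b) c = a * br b c + b * br a c)
    (hright : ∀ a b c : A, br a (b * c) = b * br a c + c * br a b)
    (S : Submonoid A) [IsLocalization S B] :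
    ∃ P : Derivation R B (Derivation R B B),
      ∀ a b : A, P (algebraMap A B a) (algebraMap A B b) = algebraMap A B (br a b) := by
  have hex (a : A) : ∃ D : Derivation R B B,
      ∀ b : A, D (algebraMap A B b) = algebraMap A B (br a b) :=
    Derivation.exists_extension_of_isLocalization S
      (Derivation.mk' ((IsScalarTower.toAlgHom R A B).toLinearMap ∘ₗ br a) fun b c ↦ by
        simp [hright, Algebra.smul_def])
  choose E hE using hex
  let E' : Derivation R A (Derivation R B B) := Derivation.mk'
    { toFun := E
      map_add' := fun a b ↦ Derivation.ext_of_isLocalization S fun c ↦ by simp [hE]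
      map_smul' := fun r a ↦ Derivation.ext_of_isLocalization S fun c ↦ by
        rw [Derivation.smul_apply, hE, hE, map_smul, LinearMap.smul_apply]
        exact map_smul (IsScalarTower.toAlgHom R A B) r _ }
    fun a b ↦ Derivation.ext_of_isLocalization S fun c ↦ by
      simp [hE, hleft, Algebra.smul_def]
  obtain ⟨P, hP⟩ := Derivation.exists_extension_of_isLocalization (B := B) S E'
  exact ⟨P, fun a b ↦ by rw [hP]; exact hE a b⟩

end

section

variable {R A B : Type*} [CommRing R] [CommRing A] [CommRing B] [Algebra R B] [Algebra A B]

/-- A biderivation on a localization is skew-symmetric if it is so on the base ring. -/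
theorem Derivation.skew_of_isLocalization (S : Submonoid A) [IsLocalization S B]
    (P : Derivation R B (Derivation R B B))
    (h : ∀ a b : A, P (algebraMap A B a) (algebraMap A B b) =
      -P (algebraMap A B b) (algebraMap A B a)) (x y : B) : P x y = -P y x := by
  have key (u v : B) (huv : ∀ a : A, P u (algebraMap A B a) = -P (algebraMap A B a) u) :
      P u v = -P v u :=
    DFunLike.congr_fun (Derivation.ext_of_isLocalization S
      (D₁ := P u) (D₂ := -(Derivation.evalLinearMap u).compDer P) huv) v
  refine key x y fun a ↦ ?_
  rw [key (algebraMap A B a) x (h a), neg_neg]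

/-- A skew-symmetric biderivation on a localization satisfies the Jacobi identity if it does so
on the base ring. -/
theorem Derivation.jacobi_of_isLocalization (S : Submonoid A) [IsLocalization S B]
    (P : Derivation R B (Derivation R B B)) (hskew : ∀ x y : B, P x y = -P y x)
    (h : ∀ a b c : A,
      P (algebraMap A B a) (P (algebraMap A B b) (algebraMap A B c)) +
      P (algebraMap A B c) (P (algebraMap A B a) (algebraMap A B b)) +
      P (algebraMap A B b) (P (algebraMap A B c) (algebraMap A B a)) = 0) (x y z : B) :
    P x (P y z) + P z (P x y) + P y (P z x) = 0 := by
  have jacobiator (u v w : B) :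
      P u (P v w) + P w (P u v) + P v (P w u) = (⁅P u, P v⁆ - P (P u v)) w := by
    rw [Derivation.sub_apply, Derivation.commutator_apply, hskew w (P u v), hskew w u, map_neg]
    ring
  have key (u v w : B) (huv : ∀ a : A, P u (P v (algebraMap A B a)) +
      P (algebraMap A B a) (P u v) + P v (P (algebraMap A B a) u) = 0) :
      P u (P v w) + P w (P u v) + P v (P w u) = 0 := by
    rw [jacobiator]
    exact DFunLike.congr_fun (Derivation.ext_of_isLocalization S
      (D₁ := ⁅P u, P v⁆ - P (P u v)) (D₂ := 0) fun a ↦ (jacobiator _ _ _).symm.trans (huv a)) w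
  refine key x y z fun c ↦ ?_
  have hc := key (algebraMap A B c) x y fun b ↦ ?_
  · linear_combination hc
  · have hb := key (algebraMap A B b) (algebraMap A B c) x fun a ↦ h b c a
    linear_combination hb

end


/-- If `S` is a Poisson multiplicative set in a Poisson ℂ-algebra `A`, then
the localization `A[S⁻¹]` carries a Poisson bracket making the localization map a homomorphism
of Poisson algebras. -/
theorem localization_poisson_bracket
    (A : Type*) [CommRing A] [Algebra ℂ A]
    (br : A →ₗ[ℂ] A →ₗ[ℂ] A)
    (hskew : ∀ a b : A, br a b = -br b a)
    (hjac : ∀ a b c : A, br a (br b c) + br c (br a b) + br b (br c a) = 0)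
    (hleib : ∀ a b c : A, br a (b * c) = br a b * c + b * br a c)
    (S : Submonoid A)
    (hS : ∀ s ∈ S, ∀ t ∈ S, br s t ∈ S ∨ br s t = 0)
    (B : Type*) [CommRing B] [Algebra ℂ B] [Algebra A B] [IsScalarTower ℂ A B]
    [IsLocalization S B] :
    ∃ br' : B →ₗ[ℂ] B →ₗ[ℂ] B,
      (∀ x y : B, br' x y = -br' y x) ∧
      (∀ x y z : B, br' x (br' y z) + br' z (br' x y) + br' y (br' z x) = 0) ∧
      (∀ x y z : B, br' x (y * z) = br' x y * z + y * br' x z) ∧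
      (∀ a b : A, br' (algebraMap A B a) (algebraMap A B b) = algebraMap A B (br a b)) := by
  obtain ⟨P, hP⟩ := exists_biderivation_of_isLocalization (B := B) br
    (fun a b c ↦ by rw [hskew, hleib, hskew c a, hskew c b]; ring)
    (fun a b c ↦ by rw [hleib]; ring) S
  have hskew' := P.skew_of_isLocalization S fun a b ↦ by rw [hP, hP, hskew, map_neg]
  refine ⟨LinearMap.mk₂ ℂ (fun x y ↦ P x y) (fun _ _ _ ↦ by simp) (fun _ _ _ ↦ by simp)
    (fun _ _ _ ↦ by simp) (fun _ _ _ ↦ by simp), hskew', ?_, fun x y z ↦ ?_, hP⟩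
  · exact P.jacobi_of_isLocalization S hskew' fun a b c ↦ by
      simp only [hP, ← map_add, hjac, map_zero]
  · simp only [LinearMap.mk₂_apply, Derivation.leibniz, smul_eq_mul]
    ring
end

section
/- Let A be a commutative ℂ-algebra equipped with a Poisson bracket {·,·} and let I ⊆ A be a Poisson ideal. Then every prime ideal of A that is minimal over I (i.e. every prime P ⊇ I such that no prime ideal Q satisfies I ⊆ Q ⊊ P) is a Poisson ideal. -/
namespace Ideal

/-- The kernel of `A → (A ⧸ I)_P`: the elements killed modulo `I` by some element outside `P`. -/
def saturationAtPrime {A : Type*} [CommRing A] (I P : Ideal A) [hP : P.IsPrime] : Ideal A where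
  carrier := {x | ∃ s ∉ P, s * x ∈ I}
  zero_mem' := ⟨1, P.one_notMem, by simp⟩
  add_mem' := by
    rintro x y ⟨s, hs, hsx⟩ ⟨t, ht, hty⟩
    refine ⟨s * t, hP.mul_notMem hs ht, ?_⟩
    convert I.add_mem (I.mul_mem_left t hsx) (I.mul_mem_left s hty) using 1
    ring
  smul_mem' := by
    rintro c x ⟨s, hs, hsx⟩
    refine ⟨s, hs, ?_⟩
    convert I.mul_mem_left c hsx using 1
    simp only [smul_eq_mul]
    ring

theorem saturationAtPrime_le {A : Type*} [CommRing A] {I P : Ideal A} [hP : P.IsPrime]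
    (hIP : I ≤ P) : I.saturationAtPrime P ≤ P := by
  rintro x ⟨s, hs, hsx⟩
  exact (hP.mem_or_mem (hIP hsx)).resolve_left hs

/-- Some power of each element of a prime minimal over `I` is killed modulo `I` by an element
outside that prime. -/
theorem exists_pow_mem_saturationAtPrime {A : Type*} [CommRing A] {I P : Ideal A} [hP : P.IsPrime]
    (hmin : ∀ Q : Ideal A, Q.IsPrime → I ≤ Q → Q ≤ P → Q = P) {x : A} (hx : x ∈ P) :
    ∃ n, x ^ n ∈ I.saturationAtPrime P := by
  by_contra! hn
  have hdisj : Disjoint (I : Set A) (P.primeCompl ⊔ Submonoid.powers x : Submonoid A) := by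
    rw [Set.disjoint_left]
    intro y hyI hy
    obtain ⟨s, hs, _, ⟨n, rfl⟩, rfl⟩ := Submonoid.mem_sup.mp hy
    exact hn n ⟨s, hs, hyI⟩
  obtain ⟨Q, hQ, hIQ, hQS⟩ := exists_le_prime_disjoint I _ hdisj
  rw [Set.disjoint_left] at hQS
  have hQP : Q ≤ P := fun y hy => by
    by_contra hyP
    exact hQS hy (Submonoid.mem_sup_left (show y ∈ P.primeCompl from hyP))
  have hxQ : x ∈ Q := hmin Q hQ hIQ hQP ▸ hx
  exact hQS hxQ (Submonoid.mem_sup_right (Submonoid.mem_powers x))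

end Ideal

namespace Derivation

variable {K A : Type*} [Field K] [CommRing A] [Algebra K A] (D : Derivation K A A)

theorem apply_mem_saturationAtPrime {I P : Ideal A} [hP : P.IsPrime]
    (hI : ∀ x ∈ I, D x ∈ I) {x : A} (hx : x ∈ I.saturationAtPrime P) :
    D x ∈ I.saturationAtPrime P := by
  obtain ⟨s, hs, hsx⟩ := hx
  refine ⟨s * s, hP.mul_notMem hs hs, ?_⟩
  have h := I.sub_mem (I.mul_mem_left s (hI _ hsx)) (I.mul_mem_left (D s) hsx)
  convert h using 1
  simp only [D.leibniz, smul_eq_mul]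
  ring

theorem exists_apply_pow_mem [CharZero K] {J : Ideal A} (hJ : ∀ x ∈ J, D x ∈ J) (x : A) (n : ℕ) :
    ∀ j, x ^ n * D x ^ j ∈ J → ∃ k, D x ^ k ∈ J := by
  induction n with
  | zero => exact fun j h => ⟨j, by simpa using h⟩
  | succ n ih =>
    intro j h
    refine ih (j + 2) ?_
    have hmul : ((n + 1 : ℕ) : A) * (x ^ n * D x ^ (j + 2)) ∈ J := by
      have h' := J.sub_mem (J.mul_mem_left (D x) (hJ _ h)) (J.mul_mem_left (j * D (D x)) h)
      convert h' using 1
      cases j <;> simp [D.leibniz, D.leibniz_pow] <;> ring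
    have hinv := J.mul_mem_left (algebraMap K A ((n + 1 : ℕ) : K)⁻¹) hmul
    rwa [← mul_assoc, ← _root_.map_natCast (algebraMap K A) (n + 1), ← map_mul,
      inv_mul_cancel₀ (Nat.cast_ne_zero.mpr n.succ_ne_zero), _root_.map_one, one_mul] at hinv

/-- In characteristic zero, a derivation preserving an ideal preserves its minimal primes. -/
theorem apply_mem_of_minimal_prime [CharZero K] {I P : Ideal A} (hP : P.IsPrime) (hIP : I ≤ P)
    (hmin : ∀ Q : Ideal A, Q.IsPrime → I ≤ Q → Q ≤ P → Q = P)
    (hI : ∀ x ∈ I, D x ∈ I) {x : A} (hx : x ∈ P) : D x ∈ P := by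
  obtain ⟨n, hn⟩ := Ideal.exists_pow_mem_saturationAtPrime hmin hx
  obtain ⟨k, hk⟩ := D.exists_apply_pow_mem
    (fun _ => D.apply_mem_saturationAtPrime hI) x n 0 (by simpa using hn)
  exact hP.mem_of_pow_mem k (Ideal.saturationAtPrime_le hIP hk)

end Derivation

/-- (Goodearl) Every prime ideal minimal over a Poisson ideal of a Poisson
ℂ-algebra is itself a Poisson ideal. -/
theorem minimal_prime_over_poisson_is_poisson
    (A : Type*) [CommRing A] [Algebra ℂ A]
    (br : A →ₗ[ℂ] A →ₗ[ℂ] A)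
    (hskew : ∀ a b : A, br a b = -br b a)
    (hjac : ∀ a b c : A, br a (br b c) + br c (br a b) + br b (br c a) = 0)
    (hleib : ∀ a b c : A, br a (b * c) = br a b * c + b * br a c)
    (I : Ideal A)
    (hI : ∀ a : A, ∀ h ∈ I, br a h ∈ I)
    (P : Ideal A) (hP : P.IsPrime) (hIP : I ≤ P)
    (hmin : ∀ Q : Ideal A, Q.IsPrime → I ≤ Q → Q ≤ P → Q = P) :
    ∀ a : A, ∀ h ∈ P, br a h ∈ P := by
  intro a h hh
  exact (Derivation.mk' (br a) fun b c => by
    rw [hleib, smul_eq_mul, smul_eq_mul]; ring).apply_mem_of_minimal_prime hP hIP hmin (hI a) hh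
end

section
/- Let G be a group acting by ring automorphisms on a commutative ring R, and assume that every G-prime ideal of R is prime. Let I be a G-stable ideal of R and let P be a prime ideal minimal over I (i.e. P ⊇ I and no prime Q satisfies I ⊆ Q ⊊ P). Then P is G-stable, i.e. g(P) = P for all g ∈ G (equivalently, P = (P : G)). -/
/-- Extending an ideal along `ρ h` and then along `ρ g` is extending it along `ρ (g * h)`. -/
theorem map_ringAut_map_ringAut {R G : Type*} [CommRing R] [Group G] (ρ : G →* RingAut R)
    (g h : G) (I : Ideal R) :
    (I.map (ρ h).toRingHom).map (ρ g).toRingHom = I.map (ρ (g * h)).toRingHom := by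
  rw [Ideal.map_map, map_mul]
  rfl

theorem map_ringAut_one {R G : Type*} [CommRing R] [Group G] (ρ : G →* RingAut R)
    (I : Ideal R) : I.map (ρ 1).toRingHom = I := by
  rw [map_one]
  exact Ideal.map_id I

/-- The intersection of the translates of an ideal is stable. -/
theorem map_ringAut_iInf_map_ringAut {R G : Type*} [CommRing R] [Group G] (ρ : G →* RingAut R)
    (I : Ideal R) (g : G) :
    (⨅ h, I.map (ρ h).toRingHom).map (ρ g).toRingHom = ⨅ h, I.map (ρ h).toRingHom := by
  have key (k : G) :
      (⨅ h, I.map (ρ h).toRingHom).map (ρ k).toRingHom ≤ ⨅ h, I.map (ρ h).toRingHom := by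
    refine le_iInf fun h => (Ideal.map_mono (iInf_le _ (k⁻¹ * h))).trans_eq ?_
    rw [map_ringAut_map_ringAut, mul_inv_cancel_left]
  refine le_antisymm (key g) ?_
  have := Ideal.map_mono (f := (ρ g).toRingHom) (key g⁻¹)
  rwa [map_ringAut_map_ringAut, mul_inv_cancel, map_ringAut_one] at this

/-- Suppose a group `G` acts by ring automorphisms on a commutative ring `R`
in such a way that every `G`-prime ideal is prime. If `I` is a `G`-stable ideal and `P` is a
prime minimal over `I`, then `P` is `G`-stable. -/
theorem minimal_prime_over_stable_is_stable
    (R : Type*) [CommRing R]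
    (G : Type*) [Group G] (ρ : G →* RingAut R)
    (hGprime : ∀ Q : Ideal R, Q ≠ ⊤ →
      (∀ g : G, Q.map (ρ g).toRingHom = Q) →
      (∀ I J : Ideal R,
        (∀ g : G, I.map (ρ g).toRingHom = I) →
        (∀ g : G, J.map (ρ g).toRingHom = J) →
        I * J ≤ Q → I ≤ Q ∨ J ≤ Q) →
      Q.IsPrime)
    (I : Ideal R) (hI : ∀ g : G, I.map (ρ g).toRingHom = I)
    (P : Ideal R) (hP : P.IsPrime) (hIP : I ≤ P)
    (hmin : ∀ Q : Ideal R, Q.IsPrime → I ≤ Q → Q ≤ P → Q = P) :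
    ∀ g : G, P.map (ρ g).toRingHom = P := by
  have hle : ⨅ h, P.map (ρ h).toRingHom ≤ P :=
    (iInf_le _ 1).trans_eq (map_ringAut_one ρ P)
  have stable_le (J : Ideal R) (hJ : ∀ g : G, J.map (ρ g).toRingHom = J) (hJP : J ≤ P) :
      J ≤ ⨅ h, P.map (ρ h).toRingHom :=
    le_iInf fun h => (hJ h).ge.trans (Ideal.map_mono hJP)
  have hprime : (⨅ h, P.map (ρ h).toRingHom).IsPrime := by
    refine hGprime _ (ne_top_of_le_ne_top hP.ne_top hle) (map_ringAut_iInf_map_ringAut ρ P) ?_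
    intro J K hJ hK hJK
    exact (hP.mul_le.mp (hJK.trans hle)).imp (stable_le J hJ) (stable_le K hK)
  intro g
  rw [← hmin _ hprime (stable_le I hI hIP) hle]
  exact map_ringAut_iInf_map_ringAut ρ P g
end
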